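/- arXiv:2505.13939 — 2 statements merged into one kernel-verified Lean document; each statement's English description precedes it below -/
import Mathlib

section
/- Let U be a neighborhood of the origin in ℝ² and let φ : U → ℝ be a function of class C³ satisfying ∂₂²φ(0,0) = 0, ∂₁∂₂²φ(0,0) = 0 and ∂₂³φ(0,0) ≠ 0. Then there exist a neighborhood V ⊆ U of the origin, a C¹ function ψ defined on an interval around 0 with ψ(0) = 0 and ψ'(0) = 0, and a continuous function B on V with B(0,0) ≠ 0, such that for all (x₁,x₂) ∈ V one has φ(x₁,x₂) = φ(x₁,ψ(x₁)) + ∂₂φ(x₁,ψ(x₁))·(x₂ − ψ(x₁)) + B(x₁,x₂)·(x₂ − ψ(x₁))³. -/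
open Set

open scoped Topology

/-- The partial derivative of `f` with respect to the second coordinate. -/
noncomputable def sndDeriv (f : ℝ × ℝ → ℝ) (p : ℝ × ℝ) : ℝ :=
  deriv (fun t => f (p.1, t)) p.2

theorem hasDerivAt_snd_of_differentiable {f : ℝ × ℝ → ℝ} (hf : Differentiable ℝ f) (s t : ℝ) :
    HasDerivAt (fun t => f (s, t)) (sndDeriv f (s, t)) t :=
  (hf.comp (by fun_prop : Differentiable ℝ fun t : ℝ => (s, t)) t).hasDerivAt

theorem sndDeriv_eq_fderiv {f : ℝ × ℝ → ℝ} (hf : Differentiable ℝ f) (p : ℝ × ℝ) :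
    sndDeriv f p = fderiv ℝ f p (0, 1) :=
  ((hf p).hasFDerivAt.comp_hasDerivAt p.2
    ((hasDerivAt_const p.2 p.1).prodMk (hasDerivAt_id p.2))).deriv

theorem ContDiff.sndDeriv {f : ℝ × ℝ → ℝ} {n m : WithTop ℕ∞} (hf : ContDiff ℝ n f)
    (hmn : m + 1 ≤ n) : ContDiff ℝ m (sndDeriv f) := by
  have hn : n ≠ 0 := by
    rintro rfl
    simp at hmn
  rw [funext (sndDeriv_eq_fderiv (hf.differentiable hn))]
  exact (hf.fderiv_right hmn).clm_apply contDiff_const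

theorem iteratedDeriv_two_eq_sndDeriv (f : ℝ × ℝ → ℝ) (s t : ℝ) :
    iteratedDeriv 2 (fun t => f (s, t)) t = sndDeriv (sndDeriv f) (s, t) := by
  simp only [iteratedDeriv_succ', iteratedDeriv_zero]
  rfl

theorem iteratedDeriv_three_eq_sndDeriv (f : ℝ × ℝ → ℝ) (s t : ℝ) :
    iteratedDeriv 3 (fun t => f (s, t)) t = sndDeriv (sndDeriv (sndDeriv f)) (s, t) := by
  simp only [iteratedDeriv_succ', iteratedDeriv_zero]
  rfl

/-- A `Cⁿ` function on a neighborhood of a point agrees near the point with a globally `Cⁿ`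
function. -/
theorem ContDiffOn.exists_contDiff_eventuallyEq {E : Type*} [NormedAddCommGroup E]
    [NormedSpace ℝ E] [HasContDiffBump E] {f : E → ℝ} {U : Set E} {x : E} {n : ℕ}
    (hf : ContDiffOn ℝ n f U) (hU : U ∈ 𝓝 x) :
    ∃ g : E → ℝ, ContDiff ℝ n g ∧ g =ᶠ[𝓝 x] f := by
  obtain ⟨r, hr, hrU⟩ := Metric.mem_nhds_iff.mp hU
  let b : ContDiffBump x := ⟨r / 4, r / 2, by linarith, by linarith⟩
  refine ⟨fun y => b y * f y, contDiff_iff_contDiffAt.2 fun y => ?_, ?_⟩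
  · by_cases hy : y ∈ Metric.ball x r
    · exact b.contDiff.contDiffAt.mul
        (hf.contDiffAt (Filter.mem_of_superset (Metric.isOpen_ball.mem_nhds hy) hrU))
    · have hyb : y ∉ tsupport b := by
        rw [b.tsupport_eq]
        intro h
        apply hy
        exact Metric.closedBall_subset_ball (half_lt_self hr) h
      have : (fun y => b y * f y) =ᶠ[𝓝 y] fun _ => 0 := by
        filter_upwards [notMem_tsupport_iff_eventuallyEq.mp hyb] with z hz
        simp [hz]
      exact contDiffAt_const.congr_of_eventuallyEq this
  · filter_upwards [b.eventuallyEq_one] with z hz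
    simp [hz]

/-- Second order Taylor formula with integral remainder along the segment from `a` to `b`. -/
theorem taylor_two_integral_remainder {f f₁ f₂ f₃ : ℝ → ℝ} (h₁ : ∀ t, HasDerivAt f (f₁ t) t)
    (h₂ : ∀ t, HasDerivAt f₁ (f₂ t) t) (h₃ : ∀ t, HasDerivAt f₂ (f₃ t) t) (hc : Continuous f₃)
    (a b : ℝ) :
    f b = f a + f₁ a * (b - a) + f₂ a * (b - a) ^ 2 / 2 +
      (∫ t in (0 : ℝ)..1, (1 - t) ^ 2 / 2 * f₃ (a + t * (b - a))) * (b - a) ^ 3 := by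
  have hG : ∀ t ∈ uIcc (0 : ℝ) 1, HasDerivAt (fun t => f (a + t * (b - a)) +
      f₁ (a + t * (b - a)) * ((1 - t) * (b - a)) +
      f₂ (a + t * (b - a)) * ((1 - t) ^ 2 * (b - a) ^ 2 / 2))
      ((1 - t) ^ 2 / 2 * f₃ (a + t * (b - a)) * (b - a) ^ 3) t := by
    intro t _
    have hl : HasDerivAt (fun t : ℝ => a + t * (b - a)) (b - a) t := by
      simpa using ((hasDerivAt_id t).mul_const (b - a)).const_add a
    have hm : HasDerivAt (fun t : ℝ => 1 - t) (-1) t := by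
      simpa using (hasDerivAt_id t).const_sub 1
    have := (((h₁ _).comp t hl).add (((h₂ _).comp t hl).mul (hm.mul_const (b - a)))).add
      (((h₃ _).comp t hl).mul (((hm.pow 2).mul_const ((b - a) ^ 2)).div_const 2))
    refine this.congr_deriv ?_
    simp
    ring
  have key := intervalIntegral.integral_eq_sub_of_hasDerivAt hG
    (Continuous.intervalIntegrable (by fun_prop) 0 1)
  rw [intervalIntegral.integral_mul_const] at key
  rw [key]
  simp
  ring

theorem continuousOn_integral_taylor_remainder {g : ℝ × ℝ → ℝ} (hg : Continuous g)
    {ψ : ℝ → ℝ} {V : Set (ℝ × ℝ)} (hψ : ContinuousOn (fun x : ℝ × ℝ => ψ x.1) V) :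
    ContinuousOn (fun x : ℝ × ℝ =>
      ∫ t in (0 : ℝ)..1, (1 - t) ^ 2 / 2 * g (x.1, ψ x.1 + t * (x.2 - ψ x.1))) V := by
  have hc : Continuous fun y : (ℝ × ℝ) × ℝ =>
      ∫ t in (0 : ℝ)..1, (1 - t) ^ 2 / 2 * g (y.1.1, y.2 + t * (y.1.2 - y.2)) :=
    intervalIntegral.continuous_parametric_intervalIntegral_of_continuous'
      (by simp only [Function.uncurry_def]; fun_prop) 0 1
  have hp : ContinuousOn (fun x : ℝ × ℝ => (x, ψ x.1)) V := continuousOn_id.prodMk hψ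
  exact hc.comp_continuousOn hp

/-- If a `C¹` function `g` on the plane vanishes at the origin, with vanishing first and nonzero
second partial derivative, its zero set contains the graph of a `C¹` function tangent to the first
axis. -/
theorem exists_implicit_tangent_zero {g : ℝ × ℝ → ℝ} (hg : ContDiff ℝ 1 g) (h0 : g (0, 0) = 0)
    (h1 : deriv (fun s => g (s, 0)) 0 = 0) (h2 : sndDeriv g (0, 0) ≠ 0) :
    ∃ ψ : ℝ → ℝ, ContDiffAt ℝ 1 ψ 0 ∧ ψ 0 = 0 ∧ deriv ψ 0 = 0 ∧
      ∀ᶠ s in 𝓝 (0 : ℝ), g (s, ψ s) = 0 := by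
  have hd : Differentiable ℝ g := hg.differentiable one_ne_zero
  have hfst : fderiv ℝ g (0, 0) (1, 0) = 0 := by
    refine Eq.trans ?_ h1
    exact (HasFDerivAt.comp_hasDerivAt (f := fun s : ℝ => (s, (0 : ℝ))) (0 : ℝ)
      (hd (0, 0)).hasFDerivAt ((hasDerivAt_id (0 : ℝ)).prodMk (hasDerivAt_const (0 : ℝ) (0 : ℝ)))).deriv.symm
  have hinv : (fderiv ℝ g (0, 0) ∘L .inr ℝ ℝ ℝ).IsInvertible := by
    rw [sndDeriv_eq_fderiv hd] at h2
    refine ⟨ContinuousLinearEquiv.unitsEquivAut ℝ (Units.mk0 _ h2), ?_⟩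
    ext
    simp
  have hinl : fderiv ℝ g (0, 0) ∘L .inl ℝ ℝ ℝ = 0 := by
    ext
    simpa using hfst
  have hga : ContDiffAt ℝ 1 g (0, 0) := hg.contDiffAt
  refine ⟨hga.implicitFunction one_ne_zero hinv, hga.contDiffAt_implicitFunction one_ne_zero hinv,
    hga.implicitFunction_apply_self one_ne_zero hinv, ?_, ?_⟩
  · have := (hga.hasStrictFDerivAt_implicitFunction one_ne_zero hinv).hasFDerivAt.hasDerivAt.deriv
    simpa [hinl] using this
  · simpa [h0] using hga.eventually_apply_implicitFunction one_ne_zero hinv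

/-- Implicit-function-theorem based decomposition (Lemma on `C³` functions).
If `φ` is `C³` near the origin with `∂₂²φ(0,0) = 0`, `∂₁∂₂²φ(0,0) = 0` and `∂₂³φ(0,0) ≠ 0`,
then there is a neighborhood `V ⊆ U`, a `C¹` function `ψ` on an interval around `0`
with `ψ 0 = 0`, `ψ' 0 = 0`, and a continuous `B` on `V` with `B (0,0) ≠ 0` such that
`φ(x₁,x₂) = φ(x₁,ψ x₁) + ∂₂φ(x₁, ψ x₁)·(x₂ - ψ x₁) + B(x₁,x₂)·(x₂ - ψ x₁)³` on `V`. -/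
theorem stmt_0 (U : Set (ℝ × ℝ)) (hU : U ∈ nhds (0 : ℝ × ℝ))
    (φ : ℝ × ℝ → ℝ) (hφ : ContDiffOn ℝ 3 φ U)
    (h22 : iteratedDeriv 2 (fun t => φ (0, t)) 0 = 0)
    (h122 : deriv (fun s => iteratedDeriv 2 (fun t => φ (s, t)) 0) 0 = 0)
    (h222 : iteratedDeriv 3 (fun t => φ (0, t)) 0 ≠ 0) :
    ∃ V ∈ nhds (0 : ℝ × ℝ), V ⊆ U ∧
      ∃ ε : ℝ, 0 < ε ∧ ∃ ψ : ℝ → ℝ,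
        ContDiffOn ℝ 1 ψ (Ioo (-ε) ε) ∧ ψ 0 = 0 ∧ deriv ψ 0 = 0 ∧
        ∃ B : ℝ × ℝ → ℝ, ContinuousOn B V ∧ B (0, 0) ≠ 0 ∧
          ∀ x ∈ V, φ x = φ (x.1, ψ x.1) +
            deriv (fun t => φ (x.1, t)) (ψ x.1) * (x.2 - ψ x.1) +
            B x * (x.2 - ψ x.1) ^ 3 := by
  obtain ⟨f, hf, hfφ⟩ := ContDiffOn.exists_contDiff_eventuallyEq (n := 3) hφ hU
  have hφf : ∀ᶠ p in 𝓝 (0 : ℝ × ℝ), ∀ᶠ q in 𝓝 p, f q = φ q := hfφ.eventually_nhds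
  have hslice : ∀ s t : ℝ, (∀ᶠ q in 𝓝 (s, t), f q = φ q) →
      (fun t => f (s, t)) =ᶠ[𝓝 t] fun t => φ (s, t) := fun s t h =>
    (by fun_prop : Continuous fun t : ℝ => (s, t)).continuousAt.eventually h
  have hf1 : ContDiff ℝ 2 (sndDeriv f) := hf.sndDeriv (by norm_num)
  have hf2 : ContDiff ℝ 1 (sndDeriv (sndDeriv f)) := hf1.sndDeriv (by norm_num)
  have hf3 : Continuous (sndDeriv (sndDeriv (sndDeriv f))) :=
    (hf2.sndDeriv (m := 0) (by norm_num)).continuous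
  have h0 : sndDeriv (sndDeriv f) (0, 0) = 0 := by
    rw [← iteratedDeriv_two_eq_sndDeriv, (hslice 0 0 hfφ).iteratedDeriv_eq, h22]
  have h1 : deriv (fun s => sndDeriv (sndDeriv f) (s, 0)) 0 = 0 := by
    refine Eq.trans (Filter.EventuallyEq.deriv_eq ?_) h122
    have hs : ∀ᶠ s in 𝓝 (0 : ℝ), ∀ᶠ q in 𝓝 (s, (0 : ℝ)), f q = φ q :=
      (by fun_prop : Continuous fun s : ℝ => (s, (0 : ℝ))).continuousAt.eventually hφf
    filter_upwards [hs] with s hs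
    rw [← iteratedDeriv_two_eq_sndDeriv, (hslice s 0 hs).iteratedDeriv_eq]
  have h2 : sndDeriv (sndDeriv (sndDeriv f)) (0, 0) ≠ 0 := by
    rwa [← iteratedDeriv_three_eq_sndDeriv, (hslice 0 0 hfφ).iteratedDeriv_eq]
  obtain ⟨ψ, hψ, hψ0, hψ', hψz⟩ := exists_implicit_tangent_zero hf2 h0 h1 h2
  obtain ⟨ε, hε, hψε⟩ : ∃ ε : ℝ, 0 < ε ∧ ContDiffOn ℝ 1 ψ (Ioo (-ε) ε) := by
    obtain ⟨ε, hε, h⟩ := Metric.eventually_nhds_iff_ball.mp (hψ.eventually (by simp))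
    refine ⟨ε, hε, fun s hs => (h s ?_).contDiffWithinAt⟩
    rwa [Real.ball_eq_Ioo, zero_sub, zero_add]
  have hgraph : ContinuousAt (fun x : ℝ × ℝ => (x.1, ψ x.1)) 0 :=
    continuousAt_fst.prodMk (ContinuousAt.comp (g := ψ) hψ.continuousAt continuousAt_fst)
  have hgraph0 : ∀ᶠ x in 𝓝 (0 : ℝ × ℝ), ∀ᶠ q in 𝓝 (x.1, ψ x.1), f q = φ q := by
    refine hgraph.eventually (p := fun p => ∀ᶠ q in 𝓝 p, f q = φ q) ?_
    beta_reduce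
    rwa [Prod.fst_zero, hψ0, ← Prod.zero_eq_mk]
  have hfst : Filter.Tendsto (Prod.fst : ℝ × ℝ → ℝ) (𝓝 0) (𝓝 0) := continuousAt_fst
  let V : Set (ℝ × ℝ) := {x | x ∈ U ∧ f x = φ x ∧ (∀ᶠ q in 𝓝 (x.1, ψ x.1), f q = φ q) ∧
    sndDeriv (sndDeriv f) (x.1, ψ x.1) = 0 ∧ x.1 ∈ Ioo (-ε) ε}
  have hV : V ∈ 𝓝 (0 : ℝ × ℝ) := by
    filter_upwards [hU, hfφ, hgraph0, hfst.eventually hψz,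
      hfst.eventually (Ioo_mem_nhds (neg_lt_zero.mpr hε) hε)] with x a b c d e
    exact ⟨a, b, c, d, e⟩
  refine ⟨V, hV, fun x hx => hx.1, ε, hε, ψ, hψε, hψ0, hψ', fun x => ∫ t in (0 : ℝ)..1,
    (1 - t) ^ 2 / 2 * sndDeriv (sndDeriv (sndDeriv f)) (x.1, ψ x.1 + t * (x.2 - ψ x.1)), ?_, ?_, ?_⟩
  · exact continuousOn_integral_taylor_remainder hf3
      (hψε.continuousOn.comp continuousOn_fst fun x hx => hx.2.2.2.2)
  · simp only [hψ0, sub_zero, mul_zero, add_zero]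
    rw [intervalIntegral.integral_mul_const]
    refine mul_ne_zero ?_ h2
    have := intervalIntegral.integral_comp_sub_left (a := 0) (b := 1) (fun t : ℝ => t ^ 2 / 2) 1
    rw [this]
    norm_num
  · rintro x ⟨-, hx, hg, hz, -⟩
    have := taylor_two_integral_remainder
      (hasDerivAt_snd_of_differentiable (hf.differentiable (by norm_num)) x.1)
      (hasDerivAt_snd_of_differentiable (hf1.differentiable (by norm_num)) x.1)
      (hasDerivAt_snd_of_differentiable (hf2.differentiable (by norm_num)) x.1)
      (by fun_prop) (ψ x.1) x.2
    rw [← hx, ← hg.self_of_nhds, ← (hslice _ _ hg).deriv_eq]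
    rw [hz, zero_mul, zero_div, add_zero] at this
    exact this
end

section
/- Let φ be a function of class C⁷ on a neighborhood U of the origin in ℝ² with φ(0) = 0 and all partial derivatives of order ≤ 2 of φ vanishing at the origin, and let p₃ and p₄ be the third and fourth Taylor homogeneous parts of φ at the origin. Then the following are equivalent: (i) φ has a singularity of type E₆ at the origin; (ii) there exist a nonzero real constant c and a nonzero linear form ℓ on ℝ² with p₃ = c·ℓ³, and the polynomials p₃ and p₄ have no common zero in ℝ² ∖ {0}. -/
open Set

/-- The mixed partial derivative `∂₁^i ∂₂^j φ (0,0)`. -/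
noncomputable def mixedPartial (φ : ℝ × ℝ → ℝ) (i j : ℕ) : ℝ :=
  iteratedDeriv i (fun s => iteratedDeriv j (fun t => φ (s, t)) 0) 0

/-- `φ` (with domain `U`, a neighborhood of the origin) has a singularity of type `E₆`
at the origin: there are a neighborhood `V` of `0`, a `C¹` map `ϕ` with `ϕ 0 = 0`,
`ϕ '' V ⊆ U`, nonzero Jacobian determinant at `0`, and a sign `ε ∈ {1, -1}` with
`φ (ϕ y) = ε·y₁⁴ + y₂³` on `V`. -/
def HasE6 (φ : ℝ × ℝ → ℝ) (U : Set (ℝ × ℝ)) : Prop :=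
  ∃ V ∈ nhds (0 : ℝ × ℝ), ∃ ϕ : ℝ × ℝ → ℝ × ℝ, ∃ ε : ℝ,
    (ε = 1 ∨ ε = -1) ∧ ContDiffOn ℝ 1 ϕ V ∧ ϕ 0 = 0 ∧ ϕ '' V ⊆ U ∧
    LinearMap.det ((fderiv ℝ ϕ 0) : (ℝ × ℝ) →ₗ[ℝ] ℝ × ℝ) ≠ 0 ∧
    ∀ y ∈ V, φ (ϕ y) = ε * y.1 ^ 4 + y.2 ^ 3

open Filter Topology

/-- Differentiation under the integral sign: an integral over `[0, 1]` of a `Cⁿ` function depends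
in a `Cⁿ` way on the parameter. -/
theorem contDiff_parametric_integral {E : Type} [NormedAddCommGroup E] [NormedSpace ℝ E]
    [ProperSpace E] (n : ℕ) : ∀ {W : Type} [NormedAddCommGroup W] [NormedSpace ℝ W]
    {F : E × ℝ → W}, ContDiff ℝ n F → ContDiff ℝ n (fun x => ∫ s in (0 : ℝ)..1, F (x, s)) := by
  induction n with
  | zero =>
    intro W _ _ F hF
    have hc : Continuous F := hF.continuous
    rw [Nat.cast_zero, contDiff_zero]
    exact intervalIntegral.continuous_parametric_intervalIntegral_of_continuous'
      (f := fun x s => F (x, s)) hc 0 1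
  | succ n ih =>
    intro W _ _ F hF
    obtain ⟨F', hF', hd⟩ := contDiff_succ_iff_hasFDerivAt.1 (by exact_mod_cast hF)
    have hc : Continuous F := hF.continuous
    have hc' : Continuous F' := hF'.continuous
    set D : E × ℝ → E →L[ℝ] W := fun p => (F' p).comp (ContinuousLinearMap.inl ℝ E ℝ) with hD
    have hDs : ContDiff ℝ n D := hF'.clm_comp contDiff_const
    have hDc : Continuous D := hDs.continuous
    push_cast
    refine contDiff_succ_iff_hasFDerivAt.2 ⟨_, ih hDs, fun x => ?_⟩
    obtain ⟨C, hC⟩ := ((isCompact_closedBall x 1).prod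
      (isCompact_Icc (a := (0 : ℝ)) (b := 1))).exists_bound_of_continuousOn hDc.continuousOn
    refine intervalIntegral.hasFDerivAt_integral_of_dominated_of_fderiv_le
      (F := fun x s => F (x, s)) (F' := fun x s => D (x, s)) (bound := fun _ => C)
      (Metric.closedBall_mem_nhds x one_pos) ?_ ?_ ?_ ?_ ?_ ?_
    · exact Eventually.of_forall fun y =>
        (hc.comp (by fun_prop : Continuous fun s : ℝ => (y, s))).aestronglyMeasurable
    · exact (hc.comp (by fun_prop : Continuous fun s : ℝ => (x, s))).intervalIntegrable _ _
    · exact (hDc.comp (by fun_prop : Continuous fun s : ℝ => (x, s))).aestronglyMeasurable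
    · refine Eventually.of_forall fun t ht y hy => hC (y, t) ⟨hy, ?_⟩
      rw [Set.uIoc_of_le zero_le_one] at ht
      exact ⟨ht.1.le, ht.2⟩
    · exact intervalIntegrable_const
    · refine Eventually.of_forall fun t _ y _ => ?_
      exact (hd (y, t)).comp y (hasFDerivAt_prodMk_left y t)

/-- Hadamard's lemma in the second variable. -/
theorem exists_hadamard_snd (n : ℕ) {F : ℝ × ℝ → ℝ} (hF : ContDiff ℝ (n + 1 : ℕ) F) :
    ∃ G : ℝ × ℝ → ℝ, ContDiff ℝ n G ∧ ∀ u v, F (u, v) = F (u, 0) + v * G (u, v) := by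
  obtain ⟨F', hF', hd⟩ := contDiff_succ_iff_hasFDerivAt.1 (by exact_mod_cast hF)
  have hH : ContDiff ℝ n (fun q : (ℝ × ℝ) × ℝ => F' (q.1.1, q.2 * q.1.2) (0, 1)) := by
    refine ContDiff.clm_apply (hF'.comp ?_) contDiff_const
    fun_prop
  refine ⟨_, contDiff_parametric_integral n hH, fun u v => ?_⟩
  have hder : ∀ s : ℝ, HasDerivAt (fun s => F (u, s * v)) (v * F' (u, s * v) (0, 1)) s := by
    intro s
    have h1 : HasDerivAt (fun s : ℝ => (u, s * v)) (0, v) s :=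
      (hasDerivAt_const s u).prodMk (by simpa using (hasDerivAt_id s).mul_const v)
    have h2 := (hd (u, s * v)).comp_hasDerivAt s h1
    have h3 : ((0 : ℝ), v) = v • ((0 : ℝ), (1 : ℝ)) := by simp
    rw [h3, map_smul, smul_eq_mul] at h2
    exact h2
  have hcont : Continuous fun s : ℝ => v * F' (u, s * v) (0, 1) := by
    have := hF'.continuous
    fun_prop
  have := intervalIntegral.integral_eq_sub_of_hasDerivAt (a := 0) (b := 1)
    (fun s _ => hder s) (hcont.intervalIntegrable _ _)
  rw [intervalIntegral.integral_const_mul] at this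
  simp only [one_mul, zero_mul] at this
  linarith

theorem iteratedDeriv_const_add_id_mul (j : ℕ) (c : ℝ) {g : ℝ → ℝ}
    (hg : ContDiff ℝ (j + 1 : ℕ) g) :
    iteratedDeriv (j + 1) (fun t => c + t * g t) 0 = (j + 1) * iteratedDeriv j g 0 := by
  rw [iteratedDeriv_const_add (by omega)]
  have := iteratedDeriv_mul (n := j + 1) (x := (0 : ℝ)) (f := fun t : ℝ => t) (g := g)
    contDiffAt_fun_id hg.contDiffAt
  change iteratedDeriv (j + 1) ((fun t : ℝ => t) * g) 0 = _
  rw [this, Finset.sum_eq_single 1]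
  · simp [iteratedDeriv_fun_id]
  · intro i _ hi
    rw [iteratedDeriv_fun_id]
    rcases i with _ | _ | i <;> simp_all
  · simp

/-- Taylor expansion in the second variable, with a remainder of controlled regularity. -/
theorem exists_taylor_snd (n k : ℕ) {F : ℝ × ℝ → ℝ} (hF : ContDiff ℝ (n + k : ℕ) F) :
    ∃ G : ℝ × ℝ → ℝ, ContDiff ℝ n G ∧ ∀ u v, F (u, v) =
      ∑ j ∈ Finset.range k, iteratedDeriv j (fun t => F (u, t)) 0 / j.factorial * v ^ j +
        v ^ k * G (u, v) := by
  induction k generalizing F with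
  | zero => exact ⟨F, hF, by simp⟩
  | succ k ih =>
    obtain ⟨H, hH, hFH⟩ := exists_hadamard_snd (n + k) hF
    obtain ⟨G, hG, hHG⟩ := ih hH
    refine ⟨G, hG, fun u v => ?_⟩
    have hu : (fun t => F (u, t)) = fun t => F (u, 0) + t * H (u, t) := funext fun t => hFH u t
    rw [Finset.sum_range_succ', hFH u v, hHG u v]
    have hj : ∀ j ∈ Finset.range k,
        iteratedDeriv (j + 1) (fun t => F (u, t)) 0 / (j + 1).factorial * v ^ (j + 1) =
          v * (iteratedDeriv j (fun t => H (u, t)) 0 / j.factorial * v ^ j) := by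
      intro j hj
      have hjk : j + 1 ≤ n + k := by have := Finset.mem_range.1 hj; omega
      have hs : ContDiff ℝ (j + 1 : ℕ) fun t => H (u, t) :=
        (hH.of_le (by exact_mod_cast hjk)).comp (by fun_prop)
      rw [hu, iteratedDeriv_const_add_id_mul j _ hs, Nat.factorial_succ]
      push_cast
      have h1 : (j : ℝ) + 1 ≠ 0 := by positivity
      have h2 : (j.factorial : ℝ) ≠ 0 := by positivity
      field_simp
      ring
    rw [Finset.sum_congr rfl hj, ← Finset.mul_sum]
    simp only [iteratedDeriv_zero, Nat.factorial_zero, Nat.cast_one, div_one, pow_zero, mul_one]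
    ring

theorem contDiff_iteratedDeriv_snd (m j : ℕ) {F : ℝ × ℝ → ℝ} (hF : ContDiff ℝ (m + j : ℕ) F) :
    ContDiff ℝ m (fun u => iteratedDeriv j (fun t => F (u, t)) 0) := by
  induction j generalizing F with
  | zero =>
    simp only [iteratedDeriv_zero]
    exact ContDiff.comp (g := F) (f := fun u : ℝ => (u, (0 : ℝ))) hF (by fun_prop)
  | succ j ih =>
    obtain ⟨F', hF', hd⟩ := contDiff_succ_iff_hasFDerivAt.1
      (by exact_mod_cast hF : ContDiff ℝ ((m + j : ℕ) + 1) F)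
    have hH : ContDiff ℝ (m + j : ℕ) fun p => F' p (0, 1) := hF'.clm_apply contDiff_const
    convert ih hH using 2 with u
    rw [iteratedDeriv_succ']
    congr 1
    funext t
    have h1 : HasDerivAt (fun t : ℝ => (u, t)) (0, 1) t :=
      (hasDerivAt_const t u).prodMk (hasDerivAt_id t)
    exact ((hd (u, t)).comp_hasDerivAt t h1).deriv

/-- `VanishesToOrder n f` says that `f` is a combination of monomials of degree `n` with
coefficients of class `C¹`. -/
def VanishesToOrder : ℕ → (ℝ × ℝ → ℝ) → Prop
  | 0, f => ContDiff ℝ 1 f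
  | n + 1, f => ∃ g h, VanishesToOrder n g ∧ VanishesToOrder n h ∧
      ∀ x : ℝ × ℝ, f x = x.1 * g x + x.2 * h x

namespace VanishesToOrder

theorem contDiff {n : ℕ} {f : ℝ × ℝ → ℝ} (hf : VanishesToOrder n f) : ContDiff ℝ 1 f := by
  induction n generalizing f with
  | zero => exact hf
  | succ n ih =>
    obtain ⟨g, h, hg, hh, hfgh⟩ := hf
    rw [funext hfgh]
    have := ih hg
    have := ih hh
    fun_prop

theorem add {n : ℕ} {f₁ f₂ : ℝ × ℝ → ℝ} (h₁ : VanishesToOrder n f₁)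
    (h₂ : VanishesToOrder n f₂) : VanishesToOrder n (fun x => f₁ x + f₂ x) := by
  induction n generalizing f₁ f₂ with
  | zero => exact ContDiff.add h₁ h₂
  | succ n ih =>
    obtain ⟨g₁, k₁, hg₁, hk₁, e₁⟩ := h₁
    obtain ⟨g₂, k₂, hg₂, hk₂, e₂⟩ := h₂
    exact ⟨_, _, ih hg₁ hg₂, ih hk₁ hk₂, fun x => by simp only [e₁, e₂]; ring⟩

theorem mul {n : ℕ} {f c : ℝ × ℝ → ℝ} (hf : VanishesToOrder n f) (hc : ContDiff ℝ 1 c) :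
    VanishesToOrder n (fun x => c x * f x) := by
  induction n generalizing f with
  | zero => exact ContDiff.mul hc hf
  | succ n ih =>
    obtain ⟨g, h, hg, hh, e⟩ := hf
    exact ⟨_, _, ih hg, ih hh, fun x => by simp only [e]; ring⟩

theorem zero (n : ℕ) : VanishesToOrder n (fun _ => 0) := by
  induction n with
  | zero => exact contDiff_const
  | succ n ih => exact ⟨_, _, ih, ih, fun x => by ring⟩

theorem sum {ι : Type} {n : ℕ} {f : ι → ℝ × ℝ → ℝ} {s : Finset ι}
    (hf : ∀ i ∈ s, VanishesToOrder n (f i)) : VanishesToOrder n (fun x => ∑ i ∈ s, f i x) := by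
  classical
  induction s using Finset.induction_on with
  | empty => simpa using zero n
  | insert a s ha ih =>
    simp only [Finset.sum_insert ha]
    exact (hf a (Finset.mem_insert_self a s)).add
      (ih fun i hi => hf i (Finset.mem_insert_of_mem hi))

theorem monomial (i j : ℕ) {c : ℝ × ℝ → ℝ} (hc : ContDiff ℝ 1 c) :
    VanishesToOrder (i + j) (fun x => x.1 ^ i * x.2 ^ j * c x) := by
  induction i with
  | zero =>
    rw [zero_add]
    induction j with
    | zero =>
      simp only [pow_zero, one_mul]
      exact hc
    | succ j ih => exact ⟨_, _, zero j, ih, fun x => by ring⟩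
  | succ i ih =>
    rw [show i + 1 + j = i + j + 1 by ring]
    exact ⟨_, _, ih, zero _, fun x => by ring⟩

theorem comp {n : ℕ} {f : ℝ × ℝ → ℝ} (hf : VanishesToOrder n f) {T : ℝ × ℝ → ℝ × ℝ}
    (hT₁ : VanishesToOrder 1 fun x => (T x).1) (hT₂ : VanishesToOrder 1 fun x => (T x).2) :
    VanishesToOrder n (fun x => f (T x)) := by
  have hT : ContDiff ℝ 1 T := hT₁.contDiff.prodMk hT₂.contDiff
  induction n generalizing f with
  | zero => exact ContDiff.comp (g := f) hf hT
  | succ n ih =>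
    obtain ⟨g, h, hg, hh, e⟩ := hf
    obtain ⟨a₁, b₁, ha₁, hb₁, e₁⟩ := hT₁
    obtain ⟨a₂, b₂, ha₂, hb₂, e₂⟩ := hT₂
    refine ⟨_, _, ((ih hg).mul ha₁.contDiff).add ((ih hh).mul ha₂.contDiff),
      ((ih hg).mul hb₁.contDiff).add ((ih hh).mul hb₂.contDiff), fun x => ?_⟩
    simp only at e₁ e₂ ⊢
    rw [e, e₁, e₂]
    ring

theorem exists_scaling {n : ℕ} {f : ℝ × ℝ → ℝ} (hf : VanishesToOrder n f) :
    ∃ k : ℝ × (ℝ × ℝ) → ℝ, Continuous k ∧ ∀ t x, f (t • x) = t ^ n * k (t, x) := by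
  induction n generalizing f with
  | zero =>
    have := hf.contDiff.continuous
    exact ⟨fun p => f (p.1 • p.2), by fun_prop, by simp⟩
  | succ n ih =>
    obtain ⟨g, h, hg, hh, e⟩ := hf
    obtain ⟨k, hk, ek⟩ := ih hg
    obtain ⟨l, hl, el⟩ := ih hh
    refine ⟨fun p => p.2.1 * k p + p.2.2 * l p, by fun_prop, fun t x => ?_⟩
    rw [e, ek, el]
    simp only [Prod.smul_fst, Prod.smul_snd, smul_eq_mul]
    ring

theorem exists_fderiv_scaling {n : ℕ} {f : ℝ × ℝ → ℝ} (hf : VanishesToOrder n f) (w : ℝ × ℝ) :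
    ∃ k : ℝ × (ℝ × ℝ) → ℝ, Continuous k ∧
      ∀ t x, t * fderiv ℝ f (t • x) w = t ^ n * k (t, x) := by
  induction n generalizing f with
  | zero =>
    have : Continuous (fderiv ℝ f) := hf.contDiff.continuous_fderiv (by simp)
    exact ⟨fun p => p.1 * fderiv ℝ f (p.1 • p.2) w, by fun_prop, by simp⟩
  | succ n ih =>
    obtain ⟨g, h, hg, hh, e⟩ := hf
    obtain ⟨k, hk, ek⟩ := ih hg
    obtain ⟨l, hl, el⟩ := ih hh
    obtain ⟨k', hk', ek'⟩ := hg.exists_scaling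
    obtain ⟨l', hl', el'⟩ := hh.exists_scaling
    refine ⟨fun p => w.1 * k' p + p.2.1 * k p + w.2 * l' p + p.2.2 * l p, by fun_prop,
      fun t x => ?_⟩
    have hd := ((hasFDerivAt_fst (𝕜 := ℝ) (p := t • x)).mul
        (hg.contDiff.differentiable (by simp) (t • x)).hasFDerivAt).add
      ((hasFDerivAt_snd (𝕜 := ℝ) (p := t • x)).mul
        (hh.contDiff.differentiable (by simp) (t • x)).hasFDerivAt)
    rw [(hd.congr_of_eventuallyEq (Eventually.of_forall e)).fderiv]
    simp only [add_apply, smul_apply, smul_eq_mul,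
      ContinuousLinearMap.coe_fst', ContinuousLinearMap.coe_snd', Prod.smul_fst, Prod.smul_snd,
      ek', el']
    linear_combination t * x.1 * ek t x + t * x.2 * el t x

theorem apply_zero {n : ℕ} (hn : n ≠ 0) {f : ℝ × ℝ → ℝ} (hf : VanishesToOrder n f) : f 0 = 0 := by
  obtain ⟨m, rfl⟩ := Nat.exists_eq_succ_of_ne_zero hn
  obtain ⟨g, h, -, -, e⟩ := hf
  simp [e]

/-- The ideal inclusion `(x₁, x₂) ^ (a + b - 1) ≤ (x₁ ^ a, x₂ ^ b)`, with control of the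
coefficients at the origin. -/
theorem exists_division {a b n : ℕ} (hn : n + 1 = a + b) {f : ℝ × ℝ → ℝ}
    (hf : VanishesToOrder n f) :
    ∃ A B : ℝ × ℝ → ℝ, ContDiff ℝ 1 A ∧ ContDiff ℝ 1 B ∧ (a < n → A 0 = 0) ∧ (b < n → B 0 = 0) ∧
      ∀ x, f x = x.1 ^ a * A x + x.2 ^ b * B x := by
  induction n generalizing f a b with
  | zero =>
    have := hf.contDiff
    rcases a with _ | a
    · exact ⟨f, 0, this, contDiff_const, by simp, by simp, by simp⟩
    · obtain rfl : b = 0 := by omega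
      exact ⟨0, f, contDiff_const, this, by simp, by simp, by simp⟩
  | succ n ih =>
    have hf0 := hf.apply_zero (by simp)
    rcases a with _ | a
    · exact ⟨f, 0, hf.contDiff, contDiff_const, fun _ => hf0, by simp, by simp⟩
    rcases b with _ | b
    · exact ⟨0, f, contDiff_const, hf.contDiff, by simp, fun _ => hf0, by simp⟩
    obtain ⟨g, h, hg, hh, e⟩ := hf
    obtain ⟨A₁, B₁, hA₁, hB₁, zA₁, -, e₁⟩ := ih (a := a) (b := b + 1) (by omega) hg
    obtain ⟨A₂, B₂, hA₂, hB₂, -, zB₂, e₂⟩ := ih (a := a + 1) (b := b) (by omega) hh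
    refine ⟨fun x => A₁ x + x.2 * A₂ x, fun x => x.1 * B₁ x + B₂ x, by fun_prop, by fun_prop,
      fun h => ?_, fun h => ?_, fun x => ?_⟩
    · simp [zA₁ (by omega)]
    · simp [zB₂ (by omega)]
    · rw [e, e₁, e₂]
      ring

end VanishesToOrder

/-- The `k`-th Taylor homogeneous part at the origin. -/
noncomputable def taylorPart (φ : ℝ × ℝ → ℝ) (k : ℕ) (x : ℝ × ℝ) : ℝ :=
  ∑ i ∈ Finset.range (k + 1),
    (mixedPartial φ i (k - i) / (Nat.factorial i * Nat.factorial (k - i))) *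
      x.1 ^ i * x.2 ^ (k - i)

theorem contDiff_taylorPart (φ : ℝ × ℝ → ℝ) (k : ℕ) {n : WithTop ℕ∞} :
    ContDiff ℝ n (taylorPart φ k) := by
  unfold taylorPart
  fun_prop

theorem taylorPart_smul (φ : ℝ × ℝ → ℝ) (k : ℕ) (t : ℝ) (x : ℝ × ℝ) :
    taylorPart φ k (t • x) = t ^ k * taylorPart φ k x := by
  unfold taylorPart
  rw [Finset.mul_sum]
  refine Finset.sum_congr rfl fun i hi => ?_
  have hik : i ≤ k := by have := Finset.mem_range.1 hi; omega
  obtain ⟨j, rfl⟩ := Nat.exists_eq_add_of_le hik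
  simp only [Prod.smul_fst, Prod.smul_snd, smul_eq_mul, Nat.add_sub_cancel_left]
  ring

/-- Taylor's formula in the plane. -/
theorem exists_taylor (N : ℕ) {F : ℝ × ℝ → ℝ} (hF : ContDiff ℝ (N + 1 : ℕ) F) :
    ∃ r, VanishesToOrder N r ∧ ∀ x, F x = ∑ k ∈ Finset.range N, taylorPart F k x + r x := by
  obtain ⟨G, hG, eG⟩ := exists_taylor_snd 1 N (by rwa [add_comm] : ContDiff ℝ (1 + N : ℕ) F)
  have hstep : ∀ j, ∃ H : ℝ × ℝ → ℝ, j < N → ContDiff ℝ 1 H ∧ ∀ u,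
      iteratedDeriv j (fun t => F (u, t)) 0 = ∑ i ∈ Finset.range (N - j),
        mixedPartial F i j / i.factorial * u ^ i + u ^ (N - j) * H (0, u) := by
    intro j
    by_cases hj : j < N
    · have h1 : ContDiff ℝ (1 + (N - j) : ℕ) fun u => iteratedDeriv j (fun t => F (u, t)) 0 :=
        contDiff_iteratedDeriv_snd _ j (by
          rwa [show 1 + (N - j) + j = N + 1 by omega])
      obtain ⟨H, hH, eH⟩ := exists_taylor_snd 1 (N - j)
        (F := fun p => iteratedDeriv j (fun t => F (p.2, t)) 0) (h1.comp contDiff_snd)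
      exact ⟨H, fun _ => ⟨by exact_mod_cast hH, fun u => eH 0 u⟩⟩
    · exact ⟨0, fun h => absurd h hj⟩
  choose H hH using hstep
  refine ⟨fun x => ∑ j ∈ Finset.range N, x.1 ^ (N - j) * x.2 ^ j * (H j (0, x.1) / j.factorial) +
    x.1 ^ 0 * x.2 ^ N * G x, ?_, ?_⟩
  · refine VanishesToOrder.add (VanishesToOrder.sum fun j hj => ?_) ?_
    · have hjN := Finset.mem_range.1 hj
      have h1 := (hH j hjN).1
      have := VanishesToOrder.monomial (N - j) j
        (c := fun x => H j (0, x.1) / j.factorial) (by fun_prop)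
      rwa [Nat.sub_add_cancel hjN.le] at this
    · have := VanishesToOrder.monomial 0 N (c := G) (by exact_mod_cast hG)
      rwa [zero_add] at this
  · rintro ⟨u, v⟩
    have hflip : ∑ k ∈ Finset.range N, taylorPart F k (u, v) =
        ∑ j ∈ Finset.range N, ∑ i ∈ Finset.range (N - j),
          mixedPartial F i j / (i.factorial * j.factorial) * u ^ i * v ^ j := by
      rw [← Finset.sum_range_diag_flip N fun j i =>
        mixedPartial F i j / (i.factorial * j.factorial) * u ^ i * v ^ j]
      refine Finset.sum_congr rfl fun k _ => ?_
      unfold taylorPart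
      rw [← Finset.sum_range_reflect]
      refine Finset.sum_congr rfl fun i hi => ?_
      have hik : i ≤ k := by have := Finset.mem_range.1 hi; omega
      rw [show k + 1 - 1 - i = k - i by omega, Nat.sub_sub_self hik]
    rw [eG, hflip, ← add_assoc, ← Finset.sum_add_distrib, pow_zero, one_mul]
    congr 1
    refine Finset.sum_congr rfl fun j hj => ?_
    rw [(hH j (Finset.mem_range.1 hj)).2 u, add_div, add_mul, Finset.sum_div, Finset.sum_mul]
    congr 1
    · exact Finset.sum_congr rfl fun i _ => by ring
    · ring

theorem exists_contDiff_extension {n : ℕ} {U : Set (ℝ × ℝ)} (hU : U ∈ 𝓝 (0 : ℝ × ℝ))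
    {φ : ℝ × ℝ → ℝ} (hφ : ContDiffOn ℝ n φ U) :
    ∃ F : ℝ × ℝ → ℝ, ContDiff ℝ n F ∧ F =ᶠ[𝓝 0] φ := by
  obtain ⟨δ, hδ, hball⟩ := Metric.mem_nhds_iff.1 hU
  let χ : ContDiffBump (0 : ℝ × ℝ) := ⟨δ / 4, δ / 2, by positivity, by linarith⟩
  refine ⟨fun x => χ x * φ x, contDiff_iff_contDiffAt.2 fun x => ?_, ?_⟩
  · by_cases hx : x ∈ Metric.ball 0 δ
    · exact χ.contDiffAt.mul
        (hφ.contDiffAt (mem_of_superset (Metric.isOpen_ball.mem_nhds hx) hball))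
    · have hx' : x ∈ (tsupport χ)ᶜ := by
        rw [χ.tsupport_eq]
        simp only [Metric.mem_ball, dist_zero_right, not_lt, Set.mem_compl_iff,
          Metric.mem_closedBall, not_le] at hx ⊢
        change δ / 2 < _
        linarith
      refine contDiffAt_const (c := (0 : ℝ)) |>.congr_of_eventuallyEq ?_
      filter_upwards [(isClosed_tsupport χ).isOpen_compl.mem_nhds hx'] with y hy
      rw [image_eq_zero_of_notMem_tsupport hy, zero_mul]
  · filter_upwards [χ.eventuallyEq_one] with x hx
    rw [hx, Pi.one_apply, one_mul]

theorem mixedPartial_congr {F φ : ℝ × ℝ → ℝ} (h : F =ᶠ[𝓝 0] φ) (i j : ℕ) :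
    mixedPartial F i j = mixedPartial φ i j := by
  refine Filter.EventuallyEq.iteratedDeriv_eq i ?_
  have h' : ∀ᶠ p in 𝓝 (0 : ℝ) ×ˢ 𝓝 (0 : ℝ), F p = φ p := by rwa [← nhds_prod_eq]
  filter_upwards [h'.curry] with s hs
  exact Filter.EventuallyEq.iteratedDeriv_eq j hs

theorem taylorPart_congr {F φ : ℝ × ℝ → ℝ} (h : F =ᶠ[𝓝 0] φ) (k : ℕ) :
    taylorPart F k = taylorPart φ k := by
  funext x
  simp only [taylorPart, mixedPartial_congr h]

section Homogeneous

variable {P : ℝ × ℝ → ℝ} {n : ℕ}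

theorem mul_fderiv_smul_of_homogeneous (hP : ContDiff ℝ 1 P)
    (hom : ∀ (t : ℝ) x, P (t • x) = t ^ n * P x) (t : ℝ) (x w : ℝ × ℝ) :
    t * fderiv ℝ P (t • x) w = t ^ n * fderiv ℝ P x w := by
  have hd : Differentiable ℝ P := hP.differentiable (by simp)
  have h1 : HasFDerivAt (fun x : ℝ × ℝ => t • x) (t • ContinuousLinearMap.id ℝ (ℝ × ℝ)) x :=
    (hasFDerivAt_id x).const_smul t
  have h2 := (hd (t • x)).hasFDerivAt.comp x h1
  have h3 : HasFDerivAt (P ∘ fun x => t • x) (t ^ n • fderiv ℝ P x) x := by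
    rw [show (P ∘ fun x => t • x) = fun x => t ^ n * P x from funext (hom t)]
    exact (hd x).hasFDerivAt.const_mul _
  have h4 := DFunLike.congr_fun (h2.unique h3) w
  simpa using h4

/-- Euler's identity. -/
theorem fderiv_self_of_homogeneous (hP : ContDiff ℝ 1 P)
    (hom : ∀ (t : ℝ) x, P (t • x) = t ^ n * P x) (w : ℝ × ℝ) :
    fderiv ℝ P w w = n * P w := by
  have hd : Differentiable ℝ P := hP.differentiable (by simp)
  have h1 : HasDerivAt (fun t : ℝ => t • w) w 1 := by
    simpa using (hasDerivAt_id (1 : ℝ)).smul_const w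
  have h2 := (hd ((1 : ℝ) • w)).hasFDerivAt.comp_hasDerivAt (1 : ℝ) h1
  have h3 : HasDerivAt (P ∘ fun t : ℝ => t • w) (n * P w) 1 := by
    rw [show (P ∘ fun t : ℝ => t • w) = fun t => t ^ n * P w from funext fun t => hom t w]
    simpa using (hasDerivAt_pow n (1 : ℝ)).mul_const (P w)
  simpa using h2.unique h3

theorem hasDerivAt_add_smul (hP : ContDiff ℝ 1 P) (x w : ℝ × ℝ) :
    HasDerivAt (fun s : ℝ => P (x + s • w)) (fderiv ℝ P x w) 0 := by
  have h1 : HasDerivAt (fun s : ℝ => x + s • w) w 0 := by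
    simpa using ((hasDerivAt_id (0 : ℝ)).smul_const w).const_add x
  have h2 := (hP.differentiable (by simp) (x + (0 : ℝ) • w)).hasFDerivAt.comp_hasDerivAt (0 : ℝ) h1
  rw [zero_smul, add_zero] at h2
  exact h2

end Homogeneous

theorem coefficients_eq_zero (N : ℕ) {d : ℕ → ℝ} {m : ℝ → ℝ} (hm : Continuous m)
    (h : ∀ t : ℝ, t ≠ 0 → ∑ k ∈ Finset.range N, t ^ k * d k = t ^ N * m t) :
    ∀ k < N, d k = 0 := by
  induction N generalizing d with
  | zero => simp
  | succ N ih =>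
    have h0 : d 0 = 0 := by
      have h1 : Tendsto (fun t : ℝ => ∑ k ∈ Finset.range (N + 1), t ^ k * d k) (𝓝[≠] 0)
          (𝓝 (∑ k ∈ Finset.range (N + 1), (0 : ℝ) ^ k * d k)) :=
        (by fun_prop : Continuous fun t : ℝ =>
          ∑ k ∈ Finset.range (N + 1), t ^ k * d k).continuousAt.tendsto.mono_left inf_le_left
      have h2 : Tendsto (fun t : ℝ => t ^ (N + 1) * m t) (𝓝[≠] 0) (𝓝 (0 ^ (N + 1) * m 0)) :=
        (by fun_prop : Continuous fun t : ℝ =>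
          t ^ (N + 1) * m t).continuousAt.tendsto.mono_left inf_le_left
      have h3 := tendsto_nhds_unique h1 (h2.congr' (by
        filter_upwards [self_mem_nhdsWithin] with t ht
        exact (h t ht).symm))
      simpa [Finset.sum_range_succ'] using h3
    have hs := ih (d := fun k => d (k + 1)) fun t ht => by
      have h1 := h t ht
      rw [Finset.sum_range_succ', h0, mul_zero, add_zero] at h1
      apply mul_left_cancel₀ ht
      rw [Finset.mul_sum, ← mul_assoc, ← pow_succ', ← h1]
      exact Finset.sum_congr rfl fun k _ => by ring
    intro k hk
    rcases k with _ | k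
    · exact h0
    · exact hs k (by omega)

/-- Uniqueness of the homogeneous parts in a Taylor expansion. -/
theorem homogeneous_parts_unique {N : ℕ} {P Q : ℕ → ℝ × ℝ → ℝ} {r s : ℝ × ℝ → ℝ}
    (hP : ∀ k (t : ℝ) x, P k (t • x) = t ^ k * P k x)
    (hQ : ∀ k (t : ℝ) x, Q k (t • x) = t ^ k * Q k x)
    (hr : VanishesToOrder N r) (hs : VanishesToOrder N s)
    (h : ∀ x, ∑ k ∈ Finset.range N, P k x + r x = ∑ k ∈ Finset.range N, Q k x + s x)
    {k : ℕ} (hk : k < N) (x : ℝ × ℝ) : P k x = Q k x := by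
  obtain ⟨l, hl, el⟩ := hr.exists_scaling
  obtain ⟨m, hm, em⟩ := hs.exists_scaling
  refine sub_eq_zero.1 (coefficients_eq_zero N (d := fun k => P k x - Q k x)
    (m := fun t => m (t, x) - l (t, x)) (by fun_prop) (fun t _ => ?_) k hk)
  have h1 := h (t • x)
  simp only [hP, hQ, el, em] at h1
  simp only [mul_sub, Finset.sum_sub_distrib]
  linear_combination h1

/-- The low order Taylor data of a function that a `C¹` change of coordinates brings to the
`E₆` normal form. -/
theorem taylor_of_normal_form {F P₃ P₄ r : ℝ × ℝ → ℝ}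
    (hF₁ : ContDiff ℝ 1 F) (hP₃c : ContDiff ℝ 1 P₃) (hP₄c : ContDiff ℝ 1 P₄)
    (hP₃ : ∀ (t : ℝ) x, P₃ (t • x) = t ^ 3 * P₃ x) (hP₄ : ∀ (t : ℝ) x, P₄ (t • x) = t ^ 4 * P₄ x)
    (hr : VanishesToOrder 5 r) (hF : ∀ x, F x = P₃ x + P₄ x + r x)
    {ϕ : ℝ × ℝ → ℝ × ℝ} (hϕ : ContDiffAt ℝ 1 ϕ 0) (hϕ0 : ϕ 0 = 0)
    (A : (ℝ × ℝ) ≃L[ℝ] ℝ × ℝ) (hA : fderiv ℝ ϕ 0 = A) (ε : ℝ)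
    (hnf : ∀ᶠ y in 𝓝 (0 : ℝ × ℝ), F (ϕ y) = ε * y.1 ^ 4 + y.2 ^ 3) :
    (∀ y, P₃ (A y) = y.2 ^ 3) ∧ P₄ (A (1, 0)) = ε := by
  obtain ⟨k, hk, ek⟩ := hr.exists_scaling
  have hline : ∀ y : ℝ × ℝ, Tendsto (fun t : ℝ => t • y) (𝓝[≠] 0) (𝓝 0) := fun y => by
    have : Tendsto (fun t : ℝ => t • y) (𝓝 0) (𝓝 ((0 : ℝ) • y)) :=
      (by fun_prop : Continuous fun t : ℝ => t • y).continuousAt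
    rw [zero_smul] at this
    exact this.mono_left inf_le_left
  have hid : Tendsto (fun t : ℝ => t) (𝓝[≠] 0) (𝓝 0) := tendsto_id.mono_left inf_le_left
  have hϕd : HasFDerivAt ϕ (A : (ℝ × ℝ) →L[ℝ] ℝ × ℝ) 0 :=
    hA ▸ (hϕ.differentiableAt (by simp)).hasFDerivAt
  have hx : ∀ y : ℝ × ℝ, Tendsto (fun t : ℝ => t⁻¹ • ϕ (t • y)) (𝓝[≠] 0) (𝓝 (A y)) := by
    intro y
    have h1 : HasDerivAt (fun t : ℝ => t • y) y 0 := by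
      simpa using (hasDerivAt_id (0 : ℝ)).smul_const y
    have h0 : HasFDerivAt ϕ (A : (ℝ × ℝ) →L[ℝ] ℝ × ℝ) ((0 : ℝ) • y) := by simpa using hϕd
    have h2 := hasDerivAt_iff_tendsto_slope_zero.1 (h0.comp_hasDerivAt (0 : ℝ) h1)
    simpa [hϕ0] using h2
  have hsm : ∀ (y : ℝ × ℝ) (t : ℝ), t ≠ 0 → ϕ (t • y) = t • (t⁻¹ • ϕ (t • y)) := fun y t ht => by
    rw [smul_smul, mul_inv_cancel₀ ht, one_smul]
  have cubic : ∀ y, P₃ (A y) = y.2 ^ 3 := by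
    intro y
    have hx' := hx y
    set x : ℝ → ℝ × ℝ := fun t => t⁻¹ • ϕ (t • y) with hxdef
    have hkl := (hk.tendsto (0, A y)).comp (hid.prodMk_nhds hx')
    have hl : Tendsto (fun t => P₃ (x t) + t * P₄ (x t) + t ^ 2 * k (t, x t)) (𝓝[≠] 0)
        (𝓝 (P₃ (A y) + 0 * P₄ (A y) + 0 ^ 2 * k (0, A y))) :=
      (((hP₃c.continuous.tendsto _).comp hx').add
        (hid.mul ((hP₄c.continuous.tendsto _).comp hx'))).add ((hid.pow 2).mul hkl)
    have hr : Tendsto (fun t : ℝ => ε * t * y.1 ^ 4 + y.2 ^ 3) (𝓝[≠] 0)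
        (𝓝 (ε * 0 * y.1 ^ 4 + y.2 ^ 3)) :=
      ((hid.const_mul ε).mul_const _).add_const _
    have heq : (fun t => P₃ (x t) + t * P₄ (x t) + t ^ 2 * k (t, x t)) =ᶠ[𝓝[≠] 0]
        fun t : ℝ => ε * t * y.1 ^ 4 + y.2 ^ 3 := by
      filter_upwards [self_mem_nhdsWithin, (hline y).eventually hnf] with t ht h1
      rw [hsm y t ht, hF, hP₃, hP₄, ek] at h1
      simp only [Prod.smul_fst, Prod.smul_snd, smul_eq_mul] at h1
      apply mul_left_cancel₀ (pow_ne_zero 3 ht)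
      simp only [hxdef]
      linear_combination h1
    have := tendsto_nhds_unique hl (hr.congr' heq.symm)
    linarith
  refine ⟨cubic, ?_⟩
  set w := A (1, 0) with hw
  have hcub : ∀ x, fderiv ℝ P₃ x w = 0 := by
    intro x
    refine (hasDerivAt_add_smul hP₃c x w).unique ?_
    have : (fun s : ℝ => P₃ (x + s • w)) = fun _ => (A.symm x).2 ^ 3 := by
      funext s
      have : x + s • w = A (A.symm x + s • (1, 0)) := by
        rw [map_add, map_smul, A.apply_symm_apply]
      rw [this, cubic]
      simp
    rw [this]
    exact hasDerivAt_const _ _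
  obtain ⟨l, hl, el⟩ := hr.exists_fderiv_scaling w
  have hx' := hx (1, 0)
  set x : ℝ → ℝ × ℝ := fun t => t⁻¹ • ϕ (t • (1, 0)) with hxdef
  have hBc : ContinuousAt (fderiv ℝ ϕ) 0 :=
    (hϕ.fderiv_right (m := 0) (by simp)).continuousAt
  let Au : ((ℝ × ℝ) →L[ℝ] ℝ × ℝ)ˣ :=
    ⟨A, A.symm, by ext <;> simp, by ext <;> simp⟩
  have hinv : Tendsto (fun y => Ring.inverse (fderiv ℝ ϕ y)) (𝓝 0)
      (𝓝 (A.symm : (ℝ × ℝ) →L[ℝ] ℝ × ℝ)) := by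
    have h1 : ContinuousAt Ring.inverse (fderiv ℝ ϕ 0) := by
      rw [hA]
      exact NormedRing.inverse_continuousAt Au
    have h2 := h1.tendsto.comp hBc.tendsto
    rw [hA] at h2
    have h3 : Ring.inverse (A : (ℝ × ℝ) →L[ℝ] ℝ × ℝ) = A.symm := Ring.inverse_unit Au
    rwa [h3] at h2
  have hunit : ∀ᶠ y in 𝓝 (0 : ℝ × ℝ), IsUnit (fderiv ℝ ϕ y) := by
    refine hBc.tendsto.eventually (Units.isOpen.mem_nhds ?_)
    rw [hA]
    exact Au.isUnit
  have hz : Tendsto (fun t : ℝ => Ring.inverse (fderiv ℝ ϕ (t • (1, 0))) w) (𝓝[≠] 0)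
      (𝓝 (1, 0)) := by
    have h1 := ((ContinuousLinearMap.apply ℝ (ℝ × ℝ) w).continuous.tendsto _).comp
      (hinv.comp (hline (1, 0)))
    simpa [hw, Function.comp_def] using h1
  have hdiff : ∀ᶠ y in 𝓝 (0 : ℝ × ℝ), DifferentiableAt ℝ ϕ y := by
    filter_upwards [hϕ.eventually (by simp)] with y hy
    exact hy.differentiableAt (by simp)
  have hgrad : ∀ᶠ y in 𝓝 (0 : ℝ × ℝ), ∀ z, fderiv ℝ F (ϕ y) (fderiv ℝ ϕ y z) =
      4 * ε * y.1 ^ 3 * z.1 + 3 * y.2 ^ 2 * z.2 := by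
    filter_upwards [hdiff, hnf.eventually_nhds] with y hy hev z
    have h1 := (hF₁.differentiable (by simp) (ϕ y)).hasFDerivAt.comp y hy.hasFDerivAt
    have h2 := ((((hasFDerivAt_fst (𝕜 := ℝ) (p := y)).pow 4).const_mul ε).add
      ((hasFDerivAt_snd (𝕜 := ℝ) (p := y)).pow 3))
    have h3 := DFunLike.congr_fun (h1.unique (h2.congr_of_eventuallyEq hev)) z
    simp at h3
    linear_combination h3
  have heq : (fun t => 4 * ε * (Ring.inverse (fderiv ℝ ϕ (t • (1, 0))) w).1) =ᶠ[𝓝[≠] 0]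
      fun t => fderiv ℝ P₄ (x t) w + t * l (t, x t) := by
    filter_upwards [self_mem_nhdsWithin, (hline (1, 0)).eventually hunit,
      (hline (1, 0)).eventually hgrad] with t ht hu hg
    have h1 := hg (Ring.inverse (fderiv ℝ ϕ (t • (1, 0))) w)
    have h2 : fderiv ℝ ϕ (t • (1, 0)) (Ring.inverse (fderiv ℝ ϕ (t • (1, 0))) w) = w :=
      DFunLike.congr_fun (Ring.mul_inverse_cancel _ hu) w
    have h3 : ∀ q, fderiv ℝ F q w = fderiv ℝ P₄ q w + fderiv ℝ r q w := by
      intro q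
      have := (((hP₃c.differentiable (by simp) q).hasFDerivAt.add
        (hP₄c.differentiable (by simp) q).hasFDerivAt).add
        (hr.contDiff.differentiable (by simp) q).hasFDerivAt).congr_of_eventuallyEq
        (Eventually.of_forall hF)
      rw [this.fderiv]
      simp [hcub]
    rw [h2, h3, hsm (1, 0) t ht] at h1
    have h4 := mul_fderiv_smul_of_homogeneous hP₄c hP₄ t (x t) w
    have h5 := el t (x t)
    simp only [Prod.smul_fst, Prod.smul_snd, smul_eq_mul] at h1
    simp only [hxdef] at h1 h4 h5 ⊢
    apply mul_left_cancel₀ (pow_ne_zero 4 ht)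
    linear_combination -t * h1 + h4 + h5
  have hlim₁ : Tendsto (fun t : ℝ => 4 * ε * (Ring.inverse (fderiv ℝ ϕ (t • (1, 0))) w).1) (𝓝[≠] 0)
      (𝓝 (4 * ε * 1)) :=
    ((continuous_fst.tendsto _).comp hz).const_mul (4 * ε)
  have hlim₂ : Tendsto (fun t => fderiv ℝ P₄ (x t) w + t * l (t, x t)) (𝓝[≠] 0)
      (𝓝 (fderiv ℝ P₄ w w + 0 * l (0, w))) := by
    have h1 : Continuous (fderiv ℝ P₄) := hP₄c.continuous_fderiv (by simp)
    have h2 : Continuous fun q => fderiv ℝ P₄ q w := by fun_prop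
    exact ((h2.tendsto _).comp hx').add
      (hid.mul ((hl.tendsto (0, w)).comp (hid.prodMk_nhds hx')))
  have h := tendsto_nhds_unique hlim₁ (hlim₂.congr' heq.symm)
  rw [fderiv_self_of_homogeneous hP₄c hP₄ w] at h
  push_cast at h
  linarith

theorem exists_pow_three_eq (c : ℝ) : ∃ κ : ℝ, κ ^ 3 = c := by
  rcases le_total 0 c with hc | hc
  · exact ⟨c ^ ((3 : ℕ) : ℝ)⁻¹, Real.rpow_inv_natCast_pow hc (by norm_num)⟩
  · refine ⟨-(-c) ^ ((3 : ℕ) : ℝ)⁻¹, ?_⟩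
    rw [Odd.neg_pow (by decide), Real.rpow_inv_natCast_pow (by linarith) (by norm_num), neg_neg]

theorem exists_pow_four_mul_eq_one_or {a : ℝ} (ha : a ≠ 0) :
    ∃ s : ℝ, s ^ 4 * a = 1 ∨ s ^ 4 * a = -1 := by
  refine ⟨(|a|⁻¹) ^ ((4 : ℕ) : ℝ)⁻¹, ?_⟩
  rw [Real.rpow_inv_natCast_pow (by positivity) (by norm_num)]
  rcases abs_choice a with h | h <;> rw [h]
  · exact Or.inl (inv_mul_cancel₀ ha)
  · exact Or.inr (by field_simp)

/-- Linear coordinates adapted to the third and fourth Taylor homogeneous parts. -/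
theorem exists_adapted_coordinates {P₃ P₄ : ℝ × ℝ → ℝ} (hP₄c : ContDiff ℝ 1 P₄)
    (hP₄ : ∀ (t : ℝ) x, P₄ (t • x) = t ^ 4 * P₄ x) {c : ℝ} (hc : c ≠ 0)
    {ℓ : (ℝ × ℝ) →ₗ[ℝ] ℝ} (hℓ : ℓ ≠ 0) (hP₃ : ∀ x, P₃ x = c * ℓ x ^ 3)
    (hcom : ∀ x : ℝ × ℝ, x ≠ 0 → ¬(P₃ x = 0 ∧ P₄ x = 0)) :
    ∃ (E : (ℝ × ℝ) ≃L[ℝ] ℝ × ℝ) (ε : ℝ), (ε = 1 ∨ ε = -1) ∧ (∀ y, P₃ (E y) = y.2 ^ 3) ∧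
      P₄ (E (1, 0)) = ε ∧ fderiv ℝ P₄ (E (1, 0)) (E (0, 1)) = 0 := by
  have hrep : ∀ x : ℝ × ℝ, ℓ x = x.1 * ℓ (1, 0) + x.2 * ℓ (0, 1) := fun x => by
    rw [← smul_eq_mul, ← smul_eq_mul, ← map_smul, ← map_smul, ← map_add]
    simp
  obtain ⟨x₀, hx₀⟩ : ∃ x, ℓ x ≠ 0 := by
    by_contra! h
    exact hℓ (LinearMap.ext h)
  obtain ⟨κ, hκ⟩ := exists_pow_three_eq c
  have hκ0 : κ ≠ 0 := by
    rintro rfl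
    exact hc (by rw [← hκ]; norm_num)
  obtain ⟨w₀, hw₀, hℓw₀⟩ : ∃ w₀ : ℝ × ℝ, w₀ ≠ 0 ∧ ℓ w₀ = 0 := by
    refine ⟨(-ℓ (0, 1), ℓ (1, 0)), fun h => hx₀ ?_, by rw [hrep]; ring⟩
    simp only [Prod.mk_eq_zero, neg_eq_zero] at h
    rw [hrep, h.1, h.2]
    ring
  have hw₀4 : P₄ w₀ ≠ 0 := fun h => hcom w₀ hw₀ ⟨by rw [hP₃, hℓw₀]; ring, h⟩
  obtain ⟨s, hs⟩ := exists_pow_four_mul_eq_one_or hw₀4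
  rw [← hP₄] at hs
  obtain ⟨w, hw⟩ : ∃ w, w = s • w₀ := ⟨_, rfl⟩
  rw [← hw] at hs
  have hℓw : ℓ w = 0 := by rw [hw, map_smul, hℓw₀, smul_zero]
  have hε : P₄ w ≠ 0 := by rcases hs with h | h <;> rw [h] <;> norm_num
  have hw0 : w ≠ 0 := fun h => hε (by simpa [h] using hP₄ 0 w)
  obtain ⟨z₀, hz₀⟩ : ∃ z₀, z₀ = (κ * ℓ x₀)⁻¹ • x₀ := ⟨_, rfl⟩
  have hℓz₀ : ℓ z₀ = κ⁻¹ := by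
    rw [hz₀, map_smul, smul_eq_mul]
    field_simp
  obtain ⟨z, hz⟩ : ∃ z, z = z₀ - (fderiv ℝ P₄ w z₀ / (4 * P₄ w)) • w := ⟨_, rfl⟩
  have hℓz : ℓ z = κ⁻¹ := by rw [hz, map_sub, map_smul, hℓw, hℓz₀, smul_zero, sub_zero]
  let M : (ℝ × ℝ) →ₗ[ℝ] ℝ × ℝ :=
    (LinearMap.fst ℝ ℝ ℝ).smulRight w + (LinearMap.snd ℝ ℝ ℝ).smulRight z
  have hM : ∀ y, M y = y.1 • w + y.2 • z := fun y => rfl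
  have hℓM : ∀ y, ℓ (M y) = y.2 * κ⁻¹ := fun y => by
    rw [hM, map_add, map_smul, map_smul, hℓw, hℓz, smul_zero, zero_add, smul_eq_mul]
  have hinj : Function.Injective M := by
    refine (injective_iff_map_eq_zero M).2 fun y hy => ?_
    have h2 : y.2 = 0 := by
      have := hℓM y
      rw [hy, map_zero] at this
      exact (mul_eq_zero.1 this.symm).resolve_right (inv_ne_zero hκ0)
    have h1 : y.1 = 0 := by
      rw [hM, h2, zero_smul, add_zero] at hy
      exact (smul_eq_zero.1 hy).resolve_right hw0
    exact Prod.ext h1 h2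
  let E : (ℝ × ℝ) ≃L[ℝ] ℝ × ℝ := (LinearEquiv.ofInjectiveEndo M hinj).toContinuousLinearEquiv
  have hE : ∀ y, E y = M y := fun y => rfl
  have hE1 : E (1, 0) = w := by simp [hE, hM]
  have hE2 : E (0, 1) = z := by simp [hE, hM]
  refine ⟨E, P₄ w, hs, fun y => ?_, by rw [hE1], ?_⟩
  · rw [hE, hP₃, hℓM, ← hκ]
    field_simp
  · rw [hE1, hE2, hz, map_sub, map_smul, fderiv_self_of_homogeneous hP₄c hP₄, smul_eq_mul]
    push_cast
    field_simp
    ring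

/-- A function in the ideal generated by `x₁ ^ 4` and `x₂ ^ 3`, with suitable coefficients, has
an `E₆` singularity. -/
theorem hasE6_of_division {φ F : ℝ × ℝ → ℝ} {U : Set (ℝ × ℝ)} (hU : U ∈ 𝓝 (0 : ℝ × ℝ))
    (hFφ : F =ᶠ[𝓝 0] φ) {T : ℝ × ℝ → ℝ × ℝ} (hT : ContDiff ℝ 1 T) (hT0 : T 0 = 0)
    (E : (ℝ × ℝ) ≃L[ℝ] ℝ × ℝ) (hTd : HasFDerivAt T (E : (ℝ × ℝ) →L[ℝ] ℝ × ℝ) 0)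
    {A B : ℝ × ℝ → ℝ} (hA : ContDiff ℝ 1 A) (hB : ContDiff ℝ 1 B) {ε : ℝ}
    (hε : ε = 1 ∨ ε = -1) (hA0 : A 0 = ε) (hB0 : B 0 = 1)
    (h : ∀ x, F (T x) = x.1 ^ 4 * A x + x.2 ^ 3 * B x) : HasE6 φ U := by
  have hεε : ε * ε = 1 := by rcases hε with rfl | rfl <;> norm_num
  have hA0' : ε * A 0 = 1 := by rw [hA0, hεε]
  set a : ℝ × ℝ → ℝ := fun x => (ε * A x) ^ ((4 : ℕ) : ℝ)⁻¹ with ha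
  set b : ℝ × ℝ → ℝ := fun x => B x ^ ((3 : ℕ) : ℝ)⁻¹ with hb
  have hac : ContDiffAt ℝ 1 a 0 :=
    ContDiffAt.rpow_const_of_ne (by fun_prop) (by rw [hA0']; norm_num)
  have hbc : ContDiffAt ℝ 1 b 0 :=
    ContDiffAt.rpow_const_of_ne (by fun_prop) (by rw [hB0]; norm_num)
  have ha0 : a 0 = 1 := by simp only [ha, hA0', Real.one_rpow]
  have hb0 : b 0 = 1 := by simp only [hb, hB0, Real.one_rpow]
  set Ψ : ℝ × ℝ → ℝ × ℝ := fun x => (x.1 * a x, x.2 * b x) with hΨ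
  have hΨc : ContDiffAt ℝ 1 Ψ 0 :=
    (contDiffAt_fst.mul hac).prodMk (contDiffAt_snd.mul hbc)
  have hΨ0 : Ψ 0 = 0 := by simp [hΨ]
  have hΨd : HasFDerivAt Ψ
      ((ContinuousLinearEquiv.refl ℝ (ℝ × ℝ) : (ℝ × ℝ) ≃L[ℝ] ℝ × ℝ) : (ℝ × ℝ) →L[ℝ] ℝ × ℝ) 0 := by
    have h1 := (((hasFDerivAt_fst (𝕜 := ℝ) (p := (0 : ℝ × ℝ))).mul
        (hac.differentiableAt (by simp)).hasFDerivAt)).prodMk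
      ((hasFDerivAt_snd (𝕜 := ℝ) (p := (0 : ℝ × ℝ))).mul
        (hbc.differentiableAt (by simp)).hasFDerivAt)
    exact h1.congr_fderiv (by ext <;> simp [ha0, hb0])
  have hst := hΨc.hasStrictFDerivAt' hΨd one_ne_zero
  set Θ := hΨc.localInverse hΨd one_ne_zero with hΘ
  have hΘc : ContDiffAt ℝ 1 Θ 0 := by
    have := hΨc.to_localInverse hΨd one_ne_zero
    rwa [hΨ0] at this
  have hΘ0 : Θ 0 = 0 := by
    have := hΨc.localInverse_apply_image hΨd one_ne_zero
    rwa [hΨ0] at this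
  have hΘd : HasFDerivAt Θ (ContinuousLinearMap.id ℝ (ℝ × ℝ)) 0 := by
    have := hst.to_localInverse.hasFDerivAt
    rwa [hΨ0] at this
  have hright : ∀ᶠ y in 𝓝 (0 : ℝ × ℝ), Ψ (Θ y) = y := by
    have := hst.eventually_right_inverse
    rwa [hΨ0] at this
  have hΘt : Tendsto Θ (𝓝 0) (𝓝 0) := by simpa [hΘ0] using hΘc.continuousAt.tendsto
  have hTt : Tendsto T (𝓝 0) (𝓝 0) := by simpa [hT0] using hT.continuous.tendsto 0
  have hϕt : Tendsto (fun y => T (Θ y)) (𝓝 0) (𝓝 0) := hTt.comp hΘt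
  have hϕc : ContDiffAt ℝ 1 (fun y => T (Θ y)) 0 := hT.contDiffAt.comp 0 hΘc
  have hpos : ∀ᶠ x in 𝓝 (0 : ℝ × ℝ), 0 < ε * A x ∧ 0 < B x := by
    have h1 : Continuous fun x => ε * A x := by fun_prop
    exact (h1.tendsto 0 |>.eventually_const_lt (by rw [hA0']; norm_num)).and
      (hB.continuous.tendsto 0 |>.eventually_const_lt (by rw [hB0]; norm_num))
  have hnf : ∀ᶠ y in 𝓝 (0 : ℝ × ℝ), ContDiffAt ℝ 1 (fun y => T (Θ y)) y ∧ T (Θ y) ∈ U ∧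
      φ (T (Θ y)) = ε * y.1 ^ 4 + y.2 ^ 3 := by
    filter_upwards [hϕc.eventually (by simp), hϕt.eventually hU, hϕt.eventually hFφ, hright,
      hΘt.eventually hpos] with y h1 h2 h3 h4 h5
    refine ⟨h1, h2, ?_⟩
    have h6 : a (Θ y) ^ 4 = ε * A (Θ y) := Real.rpow_inv_natCast_pow h5.1.le (by norm_num)
    have h7 : b (Θ y) ^ 3 = B (Θ y) := Real.rpow_inv_natCast_pow h5.2.le (by norm_num)
    have h8 : y.1 = (Θ y).1 * a (Θ y) := by rw [← congrArg Prod.fst h4]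
    have h9 : y.2 = (Θ y).2 * b (Θ y) := by rw [← congrArg Prod.snd h4]
    rw [← h3, h, h8, h9, mul_pow, mul_pow, h6, h7]
    linear_combination -(Θ y).1 ^ 4 * A (Θ y) * hεε
  refine ⟨_, hnf, fun y => T (Θ y), ε, hε, fun y hy => hy.1.contDiffWithinAt,
    (congrArg T hΘ0).trans hT0, ?_, ?_, fun y hy => hy.2.2⟩
  · rintro _ ⟨y, hy, rfl⟩
    exact hy.2.1
  · have h1 : HasFDerivAt (fun y => T (Θ y)) (E : (ℝ × ℝ) →L[ℝ] ℝ × ℝ) 0 := by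
      rw [← hΘ0] at hTd
      exact hTd.comp (0 : ℝ × ℝ) hΘd
    rw [h1.fderiv]
    exact (LinearEquiv.isUnit_det' E.toLinearEquiv).ne_zero

theorem hasE6_of_taylorPart {φ F : ℝ × ℝ → ℝ} {U : Set (ℝ × ℝ)} (hU : U ∈ 𝓝 (0 : ℝ × ℝ))
    (hFφ : F =ᶠ[𝓝 0] φ) (hF : ContDiff ℝ 7 F) (hlow : ∀ k < 3, ∀ x, taylorPart F k x = 0)
    (E : (ℝ × ℝ) ≃L[ℝ] ℝ × ℝ) {ε : ℝ} (hε : ε = 1 ∨ ε = -1)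
    (hcub : ∀ y, taylorPart F 3 (E y) = y.2 ^ 3) (hquar : taylorPart F 4 (E (1, 0)) = ε)
    (hquar' : fderiv ℝ (taylorPart F 4) (E (1, 0)) (E (0, 1)) = 0) : HasE6 φ U := by
  have hf : ContDiff ℝ (6 + 1 : ℕ) (fun y => F (E y)) := ContDiff.comp (g := F) hF E.contDiff
  obtain ⟨r, hr, er⟩ := exists_taylor 6 hf
  obtain ⟨R, hR, eR⟩ := exists_taylor 6 (F := F) hF
  have hEv : ∀ L : (ℝ × ℝ) →L[ℝ] ℝ, VanishesToOrder 1 fun y => L y := fun L =>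
    ⟨fun _ => L (1, 0), fun _ => L (0, 1), contDiff_const, contDiff_const, fun y => by
      rw [← smul_eq_mul, ← smul_eq_mul, ← map_smul, ← map_smul, ← map_add]
      simp⟩
  have hRE : VanishesToOrder 6 fun y => R (E y) :=
    hR.comp (hEv ((ContinuousLinearMap.fst ℝ ℝ ℝ).comp (E : (ℝ × ℝ) →L[ℝ] ℝ × ℝ)))
      (hEv ((ContinuousLinearMap.snd ℝ ℝ ℝ).comp (E : (ℝ × ℝ) →L[ℝ] ℝ × ℝ)))
  have hpart : ∀ {k}, k < 6 → ∀ y, taylorPart (fun y => F (E y)) k y = taylorPart F k (E y) :=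
    fun {k} hk y => homogeneous_parts_unique (Q := fun k y => taylorPart F k (E y))
      (taylorPart_smul _) (fun k t x => by rw [map_smul, taylorPart_smul]) hr hRE
      (fun x => by rw [← er, ← eR]) hk y
  let t : ℕ → ℕ → ℝ := fun k i =>
    mixedPartial (fun y => F (E y)) i (k - i) / (Nat.factorial i * Nat.factorial (k - i))
  obtain ⟨b₀, b₁, b₂, b₃, b₄, hb⟩ : ∃ b₀ b₁ b₂ b₃ b₄ : ℝ, ∀ y : ℝ × ℝ, taylorPart F 4 (E y) =
      b₀ * y.2 ^ 4 + b₁ * y.1 * y.2 ^ 3 + b₂ * y.1 ^ 2 * y.2 ^ 2 + b₃ * y.1 ^ 3 * y.2 +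
        b₄ * y.1 ^ 4 := by
    refine ⟨t 4 0, t 4 1, t 4 2, t 4 3, t 4 4, fun y => ?_⟩
    rw [← hpart (by norm_num)]
    simp only [taylorPart, Finset.sum_range_succ, Finset.sum_range_zero, Nat.reduceSub, t]
    ring
  obtain ⟨c₀, c₁, c₂, c₃, c₄, c₅, hc⟩ : ∃ c₀ c₁ c₂ c₃ c₄ c₅ : ℝ, ∀ y : ℝ × ℝ,
      taylorPart F 5 (E y) = c₀ * y.2 ^ 5 + c₁ * y.1 * y.2 ^ 4 + c₂ * y.1 ^ 2 * y.2 ^ 3 +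
        c₃ * y.1 ^ 3 * y.2 ^ 2 + c₄ * y.1 ^ 4 * y.2 + c₅ * y.1 ^ 5 := by
    refine ⟨t 5 0, t 5 1, t 5 2, t 5 3, t 5 4, t 5 5, fun y => ?_⟩
    rw [← hpart (by norm_num)]
    simp only [taylorPart, Finset.sum_range_succ, Finset.sum_range_zero, Nat.reduceSub, t]
    ring
  have hb₄ : b₄ = ε := by
    rw [← hquar, hb]
    simp
  have hb₃ : b₃ = 0 := by
    rw [← hquar']
    refine HasDerivAt.unique ?_ (hasDerivAt_add_smul (contDiff_taylorPart F 4) (E (1, 0)) (E (0, 1)))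
    have h1 : (fun s : ℝ => taylorPart F 4 (E (1, 0) + s • E (0, 1))) =
        fun s => b₀ * s ^ 4 + b₁ * s ^ 3 + b₂ * s ^ 2 + b₃ * s + b₄ := by
      funext s
      rw [← map_smul, ← map_add, hb]
      simp
    rw [h1]
    have h2 := (((((hasDerivAt_pow 4 (0 : ℝ)).const_mul b₀).add
      ((hasDerivAt_pow 3 (0 : ℝ)).const_mul b₁)).add
      ((hasDerivAt_pow 2 (0 : ℝ)).const_mul b₂)).add
      ((hasDerivAt_id (0 : ℝ)).const_mul b₃)).add_const b₄
    exact h2.congr_deriv (by norm_num)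
  set γ : ℝ := -b₂ / 3 with hγ
  set δ : ℝ := -γ * b₁ - c₃ / 3 with hδ
  set S : ℝ × ℝ → ℝ × ℝ := fun x => (x.1, x.2 + x.1 ^ 2 * (γ + δ * x.1)) with hS
  have hSc : ContDiff ℝ 1 S := by fun_prop
  have hS₁ : VanishesToOrder 1 fun x => (S x).1 :=
    ⟨fun _ => 1, fun _ => 0, contDiff_const, contDiff_const, fun x => by simp [hS]⟩
  have hS₂ : VanishesToOrder 1 fun x => (S x).2 :=
    ⟨fun x => x.1 * (γ + δ * x.1), fun _ => 1, show ContDiff ℝ 1 _ by fun_prop, contDiff_const,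
      fun x => by simp only [hS]; ring⟩
  have hSd : HasFDerivAt S (ContinuousLinearMap.id ℝ (ℝ × ℝ)) 0 := by
    have h1 := hasFDerivAt_fst (𝕜 := ℝ) (p := (0 : ℝ × ℝ))
    have h2 := h1.prodMk ((hasFDerivAt_snd (𝕜 := ℝ) (p := (0 : ℝ × ℝ))).add
      ((h1.pow 2).mul ((h1.const_mul δ).const_add γ)))
    exact h2.congr_fderiv (by ext <;> simp)
  obtain ⟨A, B, hA, hB, hA0, hB0, hAB⟩ :=
    (hr.comp hS₁ hS₂).exists_division (a := 4) (b := 3) rfl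
  set g : ℝ × ℝ → ℝ := fun x => γ + δ * x.1
  set V : ℝ × ℝ → ℝ := fun x => x.2 + x.1 ^ 2 * g x
  set K : ℝ × ℝ → ℝ := fun x =>
    1 + b₁ * x.1 + b₀ * V x + c₂ * x.1 ^ 2 + c₁ * x.1 * V x + c₀ * V x ^ 2
  refine hasE6_of_division (T := fun x => E (S x)) (ε := ε) hU hFφ (by fun_prop) (by simp [hS]) E ?_
    (A := fun x => ε + (3 * x.2 * g x ^ 2 + x.1 ^ 2 * g x ^ 3) * K x + 3 * x.2 ^ 2 * δ * b₁ +
      3 * x.2 ^ 2 * g x * (b₀ * g x + c₂ + c₁ * x.1 * g x + c₀ * x.1 ^ 2 * g x ^ 2) +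
      (b₂ + c₃ * x.1) * (2 * x.2 * g x + x.1 ^ 2 * g x ^ 2) + c₅ * x.1 + c₄ * V x + A x)
    (B := fun x => K x + 3 * x.1 ^ 2 * g x *
      (b₀ + c₁ * x.1 + c₀ * x.2 + 2 * c₀ * x.1 ^ 2 * g x) + B x)
    (by fun_prop) (by fun_prop) hε ?_ ?_ fun x => ?_
  · have h1 : HasFDerivAt E (E : (ℝ × ℝ) →L[ℝ] ℝ × ℝ) (S 0) := E.hasFDerivAt
    exact h1.comp (0 : ℝ × ℝ) hSd
  · simp [V, hA0 (by norm_num)]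
  · simp [K, V, hB0 (by norm_num)]
  · have h1 := er (S x)
    simp only [Finset.sum_range_succ, Finset.sum_range_zero] at h1
    rw [hpart (by norm_num), hpart (by norm_num), hpart (by norm_num), hpart (by norm_num),
      hpart (by norm_num), hpart (by norm_num), hlow 0 (by norm_num), hlow 1 (by norm_num),
      hlow 2 (by norm_num), hcub, hb, hc, hAB x, hb₃, hb₄] at h1
    rw [h1]
    simp only [hS, K, V, g, hδ, hγ]
    ring

/-- invariant characterization of `E₆` type singularities for `C⁷` functions:
`φ` has an `E₆` singularity at the origin iff its third Taylor homogeneous part `p₃` is a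
nonzero constant times the cube of a nonzero linear form (`m_{S¹}(p₃) = 3`) and `p₃`, `p₄`
have no common zero outside the origin (`Res(p₃,p₄) ≠ 0`). -/
theorem stmt_2 (U : Set (ℝ × ℝ)) (hU : U ∈ nhds (0 : ℝ × ℝ))
    (φ : ℝ × ℝ → ℝ) (hφ : ContDiffOn ℝ 7 φ U) (hφ0 : φ 0 = 0)
    (hcrit : ∀ i j : ℕ, i + j ≤ 2 → mixedPartial φ i j = 0)
    (p3 p4 : ℝ × ℝ → ℝ)
    (hp3 : ∀ x : ℝ × ℝ, p3 x = ∑ i ∈ Finset.range 4,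
      (mixedPartial φ i (3 - i) / (Nat.factorial i * Nat.factorial (3 - i))) *
        x.1 ^ i * x.2 ^ (3 - i))
    (hp4 : ∀ x : ℝ × ℝ, p4 x = ∑ i ∈ Finset.range 5,
      (mixedPartial φ i (4 - i) / (Nat.factorial i * Nat.factorial (4 - i))) *
        x.1 ^ i * x.2 ^ (4 - i)) :
    HasE6 φ U ↔
      ((∃ c : ℝ, c ≠ 0 ∧ ∃ ℓ : (ℝ × ℝ) →ₗ[ℝ] ℝ, ℓ ≠ 0 ∧
          ∀ x : ℝ × ℝ, p3 x = c * (ℓ x) ^ 3) ∧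
        ∀ x : ℝ × ℝ, x ≠ 0 → ¬(p3 x = 0 ∧ p4 x = 0)) := by
  obtain ⟨F, hF, hFφ⟩ := exists_contDiff_extension (n := 7) hU (by exact_mod_cast hφ)
  have hF' : ContDiff ℝ 7 F := by exact_mod_cast hF
  have hF₁ : ContDiff ℝ 1 F := hF'.of_le (by norm_num)
  obtain rfl : p3 = taylorPart F 3 := funext fun x => by
    rw [hp3, taylorPart_congr hFφ]
    rfl
  obtain rfl : p4 = taylorPart F 4 := funext fun x => by
    rw [hp4, taylorPart_congr hFφ]
    rfl
  have hlow : ∀ k < 3, ∀ x, taylorPart F k x = 0 := fun k hk x => by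
    rw [taylorPart_congr hFφ]
    refine Finset.sum_eq_zero fun i hi => ?_
    rw [hcrit i (k - i) (by have := Finset.mem_range.1 hi; omega)]
    simp
  constructor
  · rintro ⟨V, hV, ϕ, ε, hε, hϕc, hϕ0, -, hdet, hnf⟩
    have hϕ : ContDiffAt ℝ 1 ϕ 0 := hϕc.contDiffAt hV
    let A : (ℝ × ℝ) ≃L[ℝ] ℝ × ℝ :=
      ContinuousLinearMap.toContinuousLinearEquivOfDetNeZero (fderiv ℝ ϕ 0) hdet
    have hA : fderiv ℝ ϕ 0 = A := by ext <;> rfl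
    have hϕt : Tendsto ϕ (𝓝 0) (𝓝 0) := by simpa [hϕ0] using hϕ.continuousAt.tendsto
    have hnf' : ∀ᶠ y in 𝓝 (0 : ℝ × ℝ), F (ϕ y) = ε * y.1 ^ 4 + y.2 ^ 3 := by
      filter_upwards [hV, hϕt.eventually hFφ] with y h1 h2
      rw [h2, hnf y h1]
    obtain ⟨r, hr, er⟩ := exists_taylor 5 (F := F) (hF.of_le (by norm_num))
    have hFr : ∀ x, F x = taylorPart F 3 x + taylorPart F 4 x + r x := fun x => by
      have := er x
      simp only [Finset.sum_range_succ, Finset.sum_range_zero] at this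
      rw [hlow 0 (by norm_num), hlow 1 (by norm_num), hlow 2 (by norm_num)] at this
      linarith
    obtain ⟨h3, h4⟩ := taylor_of_normal_form hF₁ (contDiff_taylorPart F 3)
      (contDiff_taylorPart F 4) (taylorPart_smul F 3) (taylorPart_smul F 4) hr hFr hϕ hϕ0 A hA ε
      hnf'
    have h3' : ∀ x, taylorPart F 3 x = (A.symm x).2 ^ 3 := fun x => by
      rw [← h3, A.apply_symm_apply]
    refine ⟨⟨1, one_ne_zero, (LinearMap.snd ℝ ℝ ℝ).comp (A.symm : (ℝ × ℝ) →ₗ[ℝ] ℝ × ℝ),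
      fun h => ?_, fun x => by rw [h3', one_mul]; rfl⟩, fun x hx ⟨hx3, hx4⟩ => hx ?_⟩
    · simpa using LinearMap.congr_fun h (A (0, 1))
    · have h5 : (A.symm x).2 = 0 := by
        rw [h3'] at hx3
        exact pow_eq_zero_iff (by norm_num) |>.1 hx3
      have h6 : A.symm x = (A.symm x).1 • ((1, 0) : ℝ × ℝ) := by
        ext <;> simp [h5]
      have h7 : x = (A.symm x).1 • A (1, 0) := by
        rw [← map_smul, ← h6, A.apply_symm_apply]
      have hε0 : ε ≠ 0 := by rcases hε with rfl | rfl <;> norm_num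
      rw [h7, taylorPart_smul, h4] at hx4
      have h8 : (A.symm x).1 = 0 := by
        exact pow_eq_zero_iff (by norm_num) |>.1 ((mul_eq_zero.1 hx4).resolve_right hε0)
      rw [h7, h8, zero_smul]
  · rintro ⟨⟨c, hc, ℓ, hℓ, hcub⟩, hcom⟩
    obtain ⟨E, ε, hε, h3, h4, h4'⟩ := exists_adapted_coordinates (contDiff_taylorPart F 4)
      (taylorPart_smul F 4) hc hℓ hcub hcom
    exact hasE6_of_taylorPart hU hFφ hF' hlow E hε h3 h4 h4'
end
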